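/- Let K be a totally real number field of degree d over ℚ. For any real Y ≥ 1, the set B^×(Y) is finite and Y^{d−1}·d^{−1/2}·R_K^{−1} ≤ |B^×(Y)| ≤ 10·(5Y+1)^{d−1}. -/

import Mathlib

open NumberField

/-- A number field is totally real if every embedding into `ℂ` takes real values. -/
def TotallyReal (K : Type*) [Field K] : Prop :=
  ∀ φ : K →+* ℂ, ∀ x : K, (φ x).im = 0

open MeasureTheory

/-- The points of `ι → ℝ` whose coordinates and whose sum of coordinates are at most `r` in
absolute value. -/
def sumBox (ι : Type*) [Fintype ι] (r : ℝ) : Set (ι → ℝ) :=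
  {x | (∀ i, |x i| ≤ r) ∧ |∑ i, x i| ≤ r}

/-- The variant of `sumBox` with strict inequalities. -/
def openSumBox (ι : Type*) [Fintype ι] (r : ℝ) : Set (ι → ℝ) :=
  {x | (∀ i, |x i| < r) ∧ |∑ i, x i| < r}

/-- A counting form of Blichfeldt's theorem. -/
theorem ZLattice.measureReal_le_ncard_mul_covolume {E : Type*} [NormedAddCommGroup E]
    [NormedSpace ℝ E] [FiniteDimensional ℝ E] [MeasurableSpace E] [BorelSpace E]
    (L : Submodule ℤ E) [DiscreteTopology L] [IsZLattice ℝ L]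
    (μ : Measure E) [μ.IsAddHaarMeasure] {S T : Set E} (hS : MeasurableSet S)
    (hT : ((L : Set E) ∩ T).Finite) (hST : ∀ a ∈ S, ∀ b ∈ S, a - b ∈ T) :
    μ.real S ≤ ((L : Set E) ∩ T).ncard * ZLattice.covolume L μ := by
  have : MeasurableVAdd L E := (inferInstance : MeasurableVAdd L.toAddSubgroup E)
  have : VAddInvariantMeasure L E μ := (inferInstance : VAddInvariantMeasure L.toAddSubgroup E μ)
  have : Countable L := inferInstance
  let b := Module.Free.chooseBasis ℤ L
  set F := ZSpan.fundamentalDomain (b.ofZLatticeBasis ℝ) with hF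
  have hfd : IsAddFundamentalDomain L F μ := ZLattice.isAddFundamentalDomain b μ
  have hFtop : μ F ≠ ⊤ := (ZSpan.fundamentalDomain_isBounded _).measure_lt_top.ne
  rw [ZLattice.covolume_eq_measure_fundamentalDomain L μ hfd]
  set N := ((L : Set E) ∩ T).ncard with hN
  have hpt (x : E) : ∑' g : L, S.indicator (1 : E → ENNReal) (-g +ᵥ x) ≤ N := by
    have h1 : ∀ g : L, S.indicator (1 : E → ENNReal) (-g +ᵥ x)
        = {g : L | -g +ᵥ x ∈ S}.indicator 1 g := fun g ↦ rfl
    rw [tsum_congr h1, ← tsum_subtype]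
    simp only [Pi.one_apply, ENNReal.tsum_set_one]
    rw [hN, ← ENat.toENNReal_coe, hT.cast_ncard_eq, ENat.toENNReal_le]
    rcases Set.eq_empty_or_nonempty {g : L | -g +ᵥ x ∈ S} with h | ⟨g₀, hg₀⟩
    · simp [h]
    · refine Set.encard_le_encard_of_injOn (f := fun g : L ↦ ((g₀ - g : L) : E)) ?_ ?_
      · intro g hg
        refine ⟨(g₀ - g).2, ?_⟩
        convert hST _ hg _ hg₀ using 1
        simp only [Submodule.vadd_def, vadd_eq_add, Submodule.coe_sub, Submodule.coe_neg]
        abel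
      · intro g _ g' _ h
        simpa using h
  have key : μ S ≤ N * μ F := by
    calc μ S = ∫⁻ x, S.indicator 1 x ∂μ := (lintegral_indicator_one hS).symm
      _ = ∑' g : L, ∫⁻ x in F, S.indicator 1 (-g +ᵥ x) ∂μ := hfd.lintegral_eq_tsum' _
      _ = ∫⁻ x in F, ∑' g : L, S.indicator 1 (-g +ᵥ x) ∂μ := by
        rw [lintegral_tsum]
        intro g
        exact ((measurable_one.indicator hS).comp (measurable_const_vadd (-g))).aemeasurable
      _ ≤ ∫⁻ x in F, N ∂μ := lintegral_mono hpt
      _ = N * μ F := by simp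
  calc μ.real S ≤ (N * μ F).toReal :=
        ENNReal.toReal_mono (ENNReal.mul_ne_top (by simp) hFtop) key
    _ = N * μ.real F := by simp [Measure.real]

open scoped Pointwise in
theorem smul_openSumBox {ι : Type*} [Fintype ι] {r : ℝ} (hr : 0 < r) :
    openSumBox ι r = r • openSumBox ι 1 := by
  ext x
  rw [Set.mem_smul_set_iff_inv_smul_mem₀ hr.ne']
  simp only [openSumBox, Set.mem_ofPred_eq, Pi.smul_apply, smul_eq_mul, ← Finset.mul_sum, abs_mul,
    abs_inv, abs_of_pos hr, inv_mul_lt_iff₀ hr, mul_one]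

theorem isOpen_openSumBox (ι : Type*) [Fintype ι] (r : ℝ) : IsOpen (openSumBox ι r) := by
  simp only [openSumBox, Set.ofPred_and, Set.ofPred_forall]
  refine IsOpen.inter (isOpen_iInter_of_finite fun i ↦ ?_) ?_
  all_goals exact isOpen_lt (by fun_prop) (by fun_prop)

open scoped Pointwise in
theorem card_le_of_separated {ι : Type*} [Fintype ι] {Y c : ℝ} (hY : 0 ≤ Y) (hc : 0 < c)
    (A : Finset (ι → ℝ)) (hA : ∀ a ∈ A, a ∈ sumBox ι Y)
    (hsep : ∀ a ∈ A, ∀ b ∈ A, a - b ∈ openSumBox ι c → a = b) :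
    (A.card : ℝ) ≤ (2 * Y / c + 1) ^ Fintype.card ι := by
  set U : ℝ → Set (ι → ℝ) := openSumBox ι with hU
  have hvol {r : ℝ} (hr : 0 < r) : volume.real (U r) = r ^ Fintype.card ι * volume.real (U 1) := by
    rw [hU, smul_openSumBox hr, Measure.real, Measure.addHaar_smul, abs_of_pos (by positivity)]
    rw [ENNReal.toReal_mul, ENNReal.toReal_ofReal (by positivity)]
    simp [Measure.real]
  have hbdd (r : ℝ) : volume (U r) ≠ ⊤ := by
    refine (Bornology.IsBounded.subset (Metric.isBounded_closedBall (x := 0) (r := |r|))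
      ?_).measure_lt_top.ne
    intro x hx
    rw [mem_closedBall_zero_iff, pi_norm_le_iff_of_nonneg (abs_nonneg r)]
    exact fun i ↦ (hx.1 i).le.trans (le_abs_self r)
  have hpos : 0 < volume.real (U 1) := by
    refine ENNReal.toReal_pos ?_ (hbdd 1)
    exact ((isOpen_openSumBox ι 1).measure_pos _ ⟨0, by simp [openSumBox]⟩).ne'
  have hdisj : (A : Set (ι → ℝ)).PairwiseDisjoint fun a ↦ a +ᵥ U (c / 2) := by
    intro a ha b hb hab
    refine Set.disjoint_left.mpr fun x hxa hxb ↦ hab (hsep a ha b hb ?_)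
    rw [Set.mem_vadd_set_iff_neg_vadd_mem] at hxa hxb
    obtain ⟨h1, h2⟩ := hxa
    obtain ⟨h3, h4⟩ := hxb
    simp only [vadd_eq_add, Pi.add_apply, Pi.neg_apply, Finset.sum_add_distrib,
      Finset.sum_neg_distrib, abs_lt] at h1 h2 h3 h4
    refine ⟨fun i ↦ ?_, ?_⟩
    · rw [Pi.sub_apply, abs_lt]
      constructor <;> linarith [h1 i, h3 i]
    · simp only [Pi.sub_apply, Finset.sum_sub_distrib]
      rw [abs_lt]
      constructor <;> linarith
  have hsub : (⋃ a ∈ A, a +ᵥ U (c / 2)) ⊆ U (Y + c / 2) := by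
    refine Set.iUnion₂_subset fun a ha x hx ↦ ?_
    rw [Set.mem_vadd_set_iff_neg_vadd_mem] at hx
    obtain ⟨h1, h2⟩ := hx
    obtain ⟨h3, h4⟩ := hA a ha
    simp only [vadd_eq_add, Pi.add_apply, Pi.neg_apply, Finset.sum_add_distrib,
      Finset.sum_neg_distrib, abs_lt] at h1 h2
    simp only [abs_le] at h3 h4
    refine ⟨fun i ↦ ?_, ?_⟩
    · rw [abs_lt]
      constructor <;> linarith [h1 i, h3 i]
    · rw [abs_lt]
      constructor <;> linarith
  have hle := measureReal_mono hsub (hbdd _)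
  rw [measureReal_biUnion_finset hdisj (fun a _ ↦
    ((isOpen_openSumBox ι _).measurableSet).const_vadd a)
      (fun a _ ↦ by rw [measure_vadd]; exact hbdd _)] at hle
  simp only [Measure.real, measure_vadd, Finset.sum_const, nsmul_eq_mul] at hle
  change A.card * volume.real _ ≤ volume.real _ at hle
  rw [hvol (by positivity : 0 < c / 2), hvol (by positivity : 0 < Y + c / 2), ← mul_assoc] at hle
  have h5 := le_of_mul_le_mul_right hle hpos
  rw [← le_div_iff₀ (by positivity), ← div_pow] at h5
  rwa [show 2 * Y / c + 1 = (Y + c / 2) / (c / 2) by field_simp]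

/-- The number of slabs of unit width for which Chebyshev's inequality is used. -/
theorem exists_slab_count (n : ℕ) : ∃ m : ℕ, 0 < m ∧
    m / (2 * Real.sqrt (n + 1)) ≤ 1 - n / (3 * (m : ℝ) ^ 2) := by
  set s := Real.sqrt (n + 1) with hs
  have hs2 : s ^ 2 = n + 1 := Real.sq_sqrt (by positivity)
  have hs1 : 1 ≤ s := by rw [hs, Real.one_le_sqrt]; linarith [n.cast_nonneg (α := ℝ)]
  set m := ⌈s⌉₊ with hm
  have hm1 : s ≤ m := Nat.le_ceil s
  have hm2 : (m : ℝ) < s + 1 := Nat.ceil_lt_add_one (by linarith)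
  have hm0 : 0 < m := Nat.ceil_pos.mpr (by linarith)
  refine ⟨m, hm0, ?_⟩
  have hn : (n : ℝ) = s ^ 2 - 1 := by linarith
  have hmp : (0 : ℝ) < m := by exact_mod_cast hm0
  rw [div_le_iff₀ (by positivity)]
  have key : 3 * (m : ℝ) ^ 3 ≤ (3 * (m : ℝ) ^ 2 - n) * (2 * s) := by
    rcases Nat.lt_or_ge m 3 with h | h
    · interval_cases m
      · rw [hn]
        have : s = 1 := by norm_num at hm1; linarith
        rw [this]; norm_num
      · have hlt : (1 : ℝ) < s := by norm_num at hm2; linarith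
        have h2 : (2 : ℝ) ≤ s ^ 2 := by
          have : 1 < s ^ 2 := by nlinarith
          rw [hs2] at this ⊢
          have : 0 < n := by
            rcases Nat.eq_zero_or_pos n with h | h
            · simp [h] at this
            · exact h
          have : (1 : ℝ) ≤ n := by exact_mod_cast this
          linarith
        rw [hn]
        have : (1.4 : ℝ) ≤ s := by nlinarith
        norm_num at hm1 ⊢
        nlinarith [mul_nonneg (sub_nonneg.mpr this) (sub_nonneg.mpr hm1)]
    · have h3 : (3 : ℝ) ≤ m := by exact_mod_cast h
      rw [hn]
      nlinarith [mul_nonneg (sub_nonneg.mpr hm1) (by linarith : 0 ≤ s + 1 - m),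
        mul_self_nonneg (s - m),
        mul_nonneg (mul_nonneg (sub_nonneg.mpr hm1) (by linarith : 0 ≤ s + 1 - m))
          (by linarith : 0 ≤ s)]
  have : (1 - n / (3 * (m : ℝ) ^ 2)) * (2 * s) = (3 * (m : ℝ) ^ 2 - n) * (2 * s) / (3 * m ^ 2) := by
    field_simp
  rw [this, le_div_iff₀ (by positivity)]
  linarith

/-- The uniform probability measure on the centred unit interval. -/
noncomputable def unifHalf : Measure ℝ := volume.restrict (Set.Icc (-1 / 2) (1 / 2))

instance : IsProbabilityMeasure unifHalf := ⟨by
  simp [unifHalf]; norm_num⟩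

theorem integral_unifHalf : ∫ x, x ∂unifHalf = 0 := by
  rw [unifHalf, integral_Icc_eq_integral_Ioc, ← intervalIntegral.integral_of_le (by norm_num)]
  norm_num

theorem memLp_unifHalf : MemLp (fun x : ℝ ↦ x) 2 unifHalf := by
  refine MemLp.of_bound (by fun_prop) (1 / 2) ?_
  filter_upwards [ae_restrict_mem measurableSet_Icc] with x hx
  rw [Real.norm_eq_abs, abs_le]
  constructor <;> linarith [hx.1, hx.2]

theorem variance_unifHalf : ProbabilityTheory.variance (fun x ↦ x) unifHalf = 1 / 12 := by
  rw [ProbabilityTheory.variance_of_integral_eq_zero (by fun_prop) integral_unifHalf]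
  rw [unifHalf, integral_Icc_eq_integral_Ioc, ← intervalIntegral.integral_of_le (by norm_num)]
  rw [integral_pow]
  norm_num

theorem measure_sum_ge (ι : Type*) [Fintype ι] {c : ℝ} (hc : 0 < c) :
    (Measure.pi fun _ : ι ↦ unifHalf).real {x | c ≤ |∑ i, x i|} ≤
      Fintype.card ι / (12 * c ^ 2) := by
  set P := Measure.pi fun _ : ι ↦ unifHalf
  have hmem (i : ι) : MemLp (fun x : ι → ℝ ↦ x i) 2 P :=
    memLp_unifHalf.comp_measurePreserving (measurePreserving_eval _ i)
  have hL : MemLp (fun x : ι → ℝ ↦ ∑ i, x i) 2 P := memLp_finsetSum _ fun i _ ↦ hmem i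
  have h0 : ∫ x, ∑ i, x i ∂P = 0 := by
    rw [integral_finsetSum _ fun i _ ↦ (hmem i).integrable (by norm_num)]
    refine Finset.sum_eq_zero fun i _ ↦ ?_
    rw [← integral_unifHalf]
    exact integral_comp_eval (μ := fun _ : ι ↦ unifHalf) (f := fun y : ℝ ↦ y) (by fun_prop)
  have hv : ProbabilityTheory.variance (fun x : ι → ℝ ↦ ∑ i, x i) P = Fintype.card ι / 12 := by
    have := ProbabilityTheory.variance_sum_pi (μ := fun _ : ι ↦ unifHalf)
      (X := fun _ x ↦ x) (fun _ ↦ memLp_unifHalf)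
    simp only [variance_unifHalf, Finset.sum_const, Finset.card_univ, nsmul_eq_mul] at this
    rw [div_eq_mul_one_div, ← this]
    congr 1
    ext x
    simp
  have h := ProbabilityTheory.meas_ge_le_variance_div_sq hL hc
  rw [h0, hv] at h
  simp only [sub_zero] at h
  refine (ENNReal.toReal_mono ENNReal.ofReal_ne_top h).trans ?_
  rw [ENNReal.toReal_ofReal (by positivity), div_div]

open scoped Pointwise in
theorem exists_slab (ι : Type*) [Fintype ι] {Y : ℝ} (hY : 0 < Y) :
    ∃ S : Set (ι → ℝ), MeasurableSet S ∧ (∀ a ∈ S, ∀ b ∈ S, a - b ∈ sumBox ι Y) ∧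
      Y ^ Fintype.card ι * (2 * Real.sqrt (Fintype.card ι + 1))⁻¹ ≤ volume.real S := by
  obtain ⟨m, hm, hmn⟩ := exists_slab_count (Fintype.card ι)
  have hmp : (0 : ℝ) < m := by exact_mod_cast hm
  set n := Fintype.card ι with hn
  set P := Measure.pi fun _ : ι ↦ unifHalf with hP
  let C : Set (ι → ℝ) := Set.univ.pi fun _ ↦ Set.Icc (-1 / 2) (1 / 2)
  have hPC : P = volume.restrict C := by
    rw [hP, volume_pi, Measure.restrict_pi_pi]; rfl
  let D : ℕ → Set (ι → ℝ) := fun k ↦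
    {x | ∑ i, x i ∈ Set.Ico (-(m / 2 : ℝ) + k) (-(m / 2 : ℝ) + k + 1)}
  have hD (k : ℕ) : MeasurableSet (D k) :=
    measurableSet_Ico.preimage (by fun_prop)
  have hC : MeasurableSet C := MeasurableSet.univ_pi fun _ ↦ measurableSet_Icc
  have hcover : {x : ι → ℝ | (m / 2 : ℝ) ≤ |∑ i, x i|}ᶜ ⊆ ⋃ k ∈ Finset.range m, D k := by
    intro x hx
    simp only [Set.mem_compl_iff, Set.mem_ofPred_eq, not_le, abs_lt] at hx
    have h0 : 0 ≤ ∑ i, x i + m / 2 := by linarith [hx.1]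
    simp only [Set.mem_iUnion, Finset.mem_range]
    refine ⟨⌊∑ i, x i + m / 2⌋₊, ?_, ?_, ?_⟩
    · rw [Nat.floor_lt h0]; linarith [hx.2]
    · linarith [Nat.floor_le h0]
    · linarith [Nat.lt_floor_add_one (∑ i, x i + m / 2 : ℝ)]
  have hsum : 1 - n / (3 * (m : ℝ) ^ 2) ≤ ∑ k ∈ Finset.range m, P.real (D k) := by
    have h1 := measure_sum_ge ι (c := (m / 2 : ℝ)) (by positivity)
    have h2 := (measureReal_mono (μ := P) hcover (measure_ne_top _ _)).trans
      (measureReal_biUnion_finset_le (Finset.range m) D)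
    rw [probReal_compl_eq_one_sub (measurableSet_le (by fun_prop) (by fun_prop))] at h2
    have h3 : (n : ℝ) / (12 * (m / 2 : ℝ) ^ 2) = n / (3 * (m : ℝ) ^ 2) := by
      congr 1; ring
    rw [h3] at h1
    linarith
  obtain ⟨k, -, hk⟩ : ∃ k ∈ Finset.range m, (2 * Real.sqrt (n + 1))⁻¹ ≤ P.real (D k) := by
    refine Finset.exists_le_of_sum_le (Finset.nonempty_range_iff.mpr hm.ne') ?_
    refine le_trans (le_of_eq ?_) (hmn.trans hsum)
    simp [div_eq_mul_inv]
  refine ⟨Y • (D k ∩ C), ((hD k).inter hC).const_smul₀ Y, ?_, ?_⟩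
  · rintro _ ⟨a, ⟨ha, ha'⟩, rfl⟩ _ ⟨b, ⟨hb, hb'⟩, rfl⟩
    have hscale {t : ℝ} (h1 : -1 ≤ t) (h2 : t ≤ 1) : |Y * t| ≤ Y := by
      rw [abs_mul, abs_of_pos hY]
      exact mul_le_of_le_one_right hY.le (abs_le.mpr ⟨h1, h2⟩)
    refine ⟨fun i ↦ ?_, ?_⟩
    · have h1 := ha' i trivial
      have h2 := hb' i trivial
      simp only [Pi.sub_apply, Pi.smul_apply, smul_eq_mul, ← mul_sub]
      exact hscale (by linarith [h1.1, h2.2]) (by linarith [h1.2, h2.1])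
    · simp only [Pi.sub_apply, Pi.smul_apply, smul_eq_mul, ← mul_sub, ← Finset.mul_sum,
        Finset.sum_sub_distrib]
      exact hscale (by linarith [ha.1, hb.2]) (by linarith [ha.2, hb.1])
  · rw [Measure.real, Measure.addHaar_smul, abs_of_pos (by positivity), ENNReal.toReal_mul,
      ENNReal.toReal_ofReal (by positivity), Module.finrank_fintype_fun_eq_card]
    gcongr
    rwa [hPC, Measure.real, Measure.restrict_apply (hD k)] at hk

theorem TotallyReal.isTotallyReal {K : Type*} [Field K] (h : TotallyReal K) : IsTotallyReal K where
  isReal w := InfinitePlace.isReal_iff.mpr <| RingHom.ext fun x ↦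
    Complex.conj_eq_iff_im.mpr (h w.embedding x)

theorem forall_realEmbedding_iff {K : Type*} [Field K] [IsTotallyReal K] (p : ℝ → Prop) (x : K) :
    (∀ σ : K →+* ℝ, p |σ x|) ↔ ∀ w : InfinitePlace K, p (w x) := by
  refine ⟨fun h w ↦ ?_, fun h σ ↦ ?_⟩
  · have hw := IsTotallyReal.isReal w
    have := h (w.embedding_of_isReal hw)
    rwa [← Real.norm_eq_abs, InfinitePlace.norm_embedding_of_isReal] at this
  · have := h (InfinitePlace.mk ((algebraMap ℝ ℂ).comp σ))
    rw [InfinitePlace.apply] at this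
    simpa using this

theorem abs_sub_inv_lt_one {x : ℝ} (hx : x ≠ 0) (h : abs (Real.log |x|) < 2 / 5) :
    |x - x⁻¹| < 1 := by
  have hexp : Real.exp (2 / 5) < 3 / 2 := by
    have h2 : Real.exp (2 / 5) ^ 5 < (3 / 2) ^ 5 := by
      rw [← Real.exp_nat_mul, show ((5 : ℕ) : ℝ) * (2 / 5) = 1 + 1 by norm_num, Real.exp_add]
      nlinarith [Real.exp_one_lt_d9, Real.exp_pos 1]
    exact lt_of_pow_lt_pow_left₀ 5 (by norm_num) h2
  obtain ⟨h1, h2⟩ := abs_lt.mp h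
  have hpos := abs_pos.mpr hx
  have hlt : |x| < 3 / 2 := ((Real.log_lt_iff_lt_exp hpos).mp h2).trans hexp
  have hgt : 2 / 3 < |x| := by
    have h3 : Real.exp (-(2 / 5)) < |x| := (Real.lt_log_iff_exp_lt hpos).mp h1
    rw [Real.exp_neg] at h3
    refine lt_trans ?_ h3
    rw [show (2 / 3 : ℝ) = (3 / 2)⁻¹ by norm_num]
    exact inv_strictAnti₀ (Real.exp_pos _) hexp
  have heq : |x - x⁻¹| * |x| = |x| ^ 2 - 1 ∨ |x - x⁻¹| * |x| = 1 - |x| ^ 2 := by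
    rw [← abs_mul, sub_mul, inv_mul_cancel₀ hx, sq_abs, sq]
    rcases abs_choice (x * x - 1) with h | h <;> rw [h]
    · exact .inl rfl
    · exact .inr (by ring)
  rcases heq with h | h <;> nlinarith

theorem eq_one_or_neg_one_of_abs_log_lt {K : Type*} [Field K] [NumberField K] [IsTotallyReal K]
    (u : (𝓞 K)ˣ) (h : ∀ w : InfinitePlace K, |Real.log (w (u : K))| < 2 / 5) :
    u = 1 ∨ u = -1 := by
  have hv : ((u : 𝓞 K) - (u⁻¹ : (𝓞 K)ˣ)) = 0 := by
    by_contra hne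
    have hlt (w : InfinitePlace K) : w (((u : 𝓞 K) - (u⁻¹ : (𝓞 K)ˣ) : 𝓞 K) : K) < 1 := by
      have hw := IsTotallyReal.isReal w
      have h1 := h w
      rw [← InfinitePlace.norm_embedding_of_isReal hw, Real.norm_eq_abs] at h1 ⊢
      have h2 := abs_sub_inv_lt_one ((map_ne_zero (w.embedding_of_isReal hw)).mpr (Units.coe_ne_zero u)) h1
      simpa using h2
    obtain ⟨w₀⟩ := (inferInstance : Nonempty (InfinitePlace K))
    exact (hlt w₀).not_ge (InfinitePlace.one_le_of_lt_one hne fun z _ ↦ hlt z)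
  have h1 : u = u⁻¹ := Units.ext (sub_eq_zero.mp hv)
  have h2 : (u : 𝓞 K) * u = 1 := by
    rw [← Units.val_mul, mul_eq_one_iff_eq_inv.mpr h1, Units.val_one]
  rcases mul_self_eq_one_iff.mp h2 with h | h
  · exact .inl (Units.ext h)
  · exact .inr (Units.ext h)

section

open NumberField.Units NumberField.Units.dirichletUnitTheorem

open scoped Classical in
theorem logEmbedding_mem_sumBox_iff {K : Type*} [Field K] [NumberField K] [IsTotallyReal K]
    (u : (𝓞 K)ˣ) (Y : ℝ) :
    logEmbedding K (Additive.ofMul u) ∈ sumBox {w : InfinitePlace K // w ≠ w₀} Y ↔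
      ∀ w : InfinitePlace K, |Real.log (w (u : K))| ≤ Y := by
  rw [sumBox, Set.mem_ofPred_eq, sum_logEmbedding_component]
  simp only [logEmbedding_component, IsTotallyReal.mult_eq, Nat.cast_one, one_mul, neg_mul, abs_neg]
  refine ⟨fun ⟨h1, h2⟩ w ↦ ?_, fun h ↦ ⟨fun w ↦ h w, h _⟩⟩
  by_cases hw : w = w₀
  · exact hw ▸ h2
  · exact h1 ⟨w, hw⟩

open scoped Classical in
theorem logEmbedding_mem_openSumBox_iff {K : Type*} [Field K] [NumberField K] [IsTotallyReal K]
    (u : (𝓞 K)ˣ) (Y : ℝ) :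
    logEmbedding K (Additive.ofMul u) ∈ openSumBox {w : InfinitePlace K // w ≠ w₀} Y ↔
      ∀ w : InfinitePlace K, |Real.log (w (u : K))| < Y := by
  rw [openSumBox, Set.mem_ofPred_eq, sum_logEmbedding_component]
  simp only [logEmbedding_component, IsTotallyReal.mult_eq, Nat.cast_one, one_mul, neg_mul, abs_neg]
  refine ⟨fun ⟨h1, h2⟩ w ↦ ?_, fun h ↦ ⟨fun w ↦ h w, h _⟩⟩
  by_cases hw : w = w₀
  · exact hw ▸ h2
  · exact h1 ⟨w, hw⟩

open scoped Classical in
theorem eq_or_eq_neg_of_logEmbedding_sub_mem {K : Type*} [Field K] [NumberField K]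
    [IsTotallyReal K] {u v : (𝓞 K)ˣ}
    (h : logEmbedding K (Additive.ofMul u) - logEmbedding K (Additive.ofMul v) ∈
      openSumBox {w : InfinitePlace K // w ≠ w₀} (2 / 5)) : u = v ∨ u = -v := by
  rw [← map_sub, ← ofMul_div, logEmbedding_mem_openSumBox_iff] at h
  rcases eq_one_or_neg_one_of_abs_log_lt _ h with h | h
  · exact .inl (div_eq_one.mp h)
  · exact .inr (by rw [div_eq_iff_eq_mul.mp h, neg_one_mul])

theorem logEmbedding_neg {K : Type*} [Field K] [NumberField K] (u : (𝓞 K)ˣ) :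
    logEmbedding K (Additive.ofMul (-u)) = logEmbedding K (Additive.ofMul u) := by
  ext w
  have h := w.val.1.map_neg (u : K)
  simp only [logEmbedding_component, Units.val_neg, map_neg]
  exact congrArg (fun t ↦ (w.val.mult : ℝ) * Real.log t) h

theorem logEmbedding_eq_iff {K : Type*} [Field K] [NumberField K] [IsTotallyReal K]
    {u v : (𝓞 K)ˣ} :
    logEmbedding K (Additive.ofMul u) = logEmbedding K (Additive.ofMul v) ↔ u = v ∨ u = -v := by
  classical
  refine ⟨fun h ↦ eq_or_eq_neg_of_logEmbedding_sub_mem ?_, ?_⟩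
  · rw [h, sub_self]
    simp [openSumBox]
  · rintro (rfl | rfl)
    · rfl
    · exact logEmbedding_neg v

open scoped Classical in
theorem finite_unitLattice_inter_sumBox (K : Type*) [Field K] [NumberField K] {Y : ℝ}
    (hY : 0 ≤ Y) :
    ((unitLattice K : Set (logSpace K)) ∩ sumBox {w : InfinitePlace K // w ≠ w₀} Y).Finite := by
  refine (unitLattice_inter_ball_finite K Y).subset (Set.inter_subset_inter_right _ fun x hx ↦ ?_)
  rw [mem_closedBall_zero_iff, pi_norm_le_iff_of_nonneg hY]
  exact hx.1

open scoped Classical in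
theorem unitBox_finite_and_ncard (K : Type*) [Field K] [NumberField K] [IsTotallyReal K] {Y : ℝ}
    (hY : 0 ≤ Y) :
    {u : (𝓞 K)ˣ | ∀ w : InfinitePlace K, |Real.log (w (u : K))| ≤ Y}.Finite ∧
    {u : (𝓞 K)ˣ | ∀ w : InfinitePlace K, |Real.log (w (u : K))| ≤ Y}.ncard =
      2 * ((unitLattice K : Set (logSpace K)) ∩
        sumBox {w : InfinitePlace K // w ≠ w₀} Y).ncard := by
  set A := {u : (𝓞 K)ˣ | ∀ w : InfinitePlace K, |Real.log (w (u : K))| ≤ Y} with hA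
  set B := (unitLattice K : Set (logSpace K)) ∩ sumBox {w : InfinitePlace K // w ≠ w₀} Y with hB
  let L : (𝓞 K)ˣ → logSpace K := fun u ↦ logEmbedding K (Additive.ofMul u)
  have hBfin : B.Finite := finite_unitLattice_inter_sumBox K hY
  have hAB : A = L ⁻¹' B := by
    ext u
    exact (logEmbedding_mem_sumBox_iff u Y).symm.trans
      ⟨fun h ↦ ⟨⟨Additive.ofMul u, trivial, rfl⟩, h⟩, fun h ↦ h.2⟩
  have himage : L '' A = B := by
    rw [hAB, Set.image_preimage_eq_iff]
    rintro x ⟨⟨u, -, rfl⟩, -⟩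
    exact ⟨u.toMul, rfl⟩
  have hfiber (v : (𝓞 K)ˣ) : {u | L u = L v} = {v, -v} := Set.ext fun u ↦ logEmbedding_eq_iff
  have hfin : A.Finite := by
    rw [hAB]
    refine hBfin.preimage' fun b hb ↦ ?_
    rw [← himage] at hb
    obtain ⟨v, -, rfl⟩ := hb
    exact (hfiber v ▸ Set.toFinite {v, -v} : {u | L u = L v}.Finite)
  refine ⟨hfin, ?_⟩
  have hBimage : B.ncard = (hfin.toFinset.image L).card := by
    rw [← himage, ← Set.ncard_coe_finset, Finset.coe_image, hfin.coe_toFinset]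
  rw [Set.ncard_eq_toFinset_card A hfin, hBimage, Finset.card_eq_sum_card_image L, mul_comm,
    ← smul_eq_mul, ← Finset.sum_const]
  refine Finset.sum_congr rfl fun b hb ↦ ?_
  obtain ⟨v, hv, rfl⟩ := Finset.mem_image.mp hb
  have : {u ∈ hfin.toFinset | L u = L v} = {v, -v} := by
    ext u
    have h1 : L u = L v ↔ u = v ∨ u = -v := logEmbedding_eq_iff
    simp only [Finset.mem_filter, Finset.mem_insert, Finset.mem_singleton, ← h1,
      and_iff_right_iff_imp]
    intro h
    rw [hfin.mem_toFinset, hAB, Set.mem_preimage] at hv ⊢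
    rwa [h]
  rw [this, Finset.card_pair]
  intro h
  exact Units.ne_zero v (CharZero.eq_neg_self_iff.mp (congrArg Units.val h))

end

/-- Let `K` be a totally real number field of degree `d`. For any `Y ≥ 1` the unit box
`B^×(Y) = {u ∈ 𝓞_K^× : |log|σ(u)|| ≤ Y for all embeddings σ : K → ℝ}` is finite and
satisfies `Y^{d-1} d^{-1/2} R_K^{-1} ≤ |B^×(Y)| ≤ 10 (5Y+1)^{d-1}`. -/
theorem statement14 (K : Type*) [Field K] [NumberField K]
    (htr : TotallyReal K) (d : ℕ) (hd : Module.finrank ℚ K = d)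
    (Y : ℝ) (hY : 1 ≤ Y) :
    {u : (𝓞 K)ˣ | ∀ σ : K →+* ℝ,
        abs (Real.log |σ (algebraMap (𝓞 K) K (u : 𝓞 K))|) ≤ Y}.Finite ∧
    Y ^ (d - 1) * (Real.sqrt d)⁻¹ * (NumberField.Units.regulator K)⁻¹ ≤
      ({u : (𝓞 K)ˣ | ∀ σ : K →+* ℝ,
        abs (Real.log |σ (algebraMap (𝓞 K) K (u : 𝓞 K))|) ≤ Y}.ncard : ℝ) ∧
    ({u : (𝓞 K)ˣ | ∀ σ : K →+* ℝ,
        abs (Real.log |σ (algebraMap (𝓞 K) K (u : 𝓞 K))|) ≤ Y}.ncard : ℝ) ≤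
      10 * (5 * Y + 1) ^ (d - 1) := by
  classical
  have := htr.isTotallyReal
  have hset : {u : (𝓞 K)ˣ | ∀ σ : K →+* ℝ,
      abs (Real.log |σ (algebraMap (𝓞 K) K (u : 𝓞 K))|) ≤ Y} =
      {u : (𝓞 K)ˣ | ∀ w : InfinitePlace K, |Real.log (w (u : K))| ≤ Y} :=
    Set.ext fun u ↦ forall_realEmbedding_iff (fun t ↦ |Real.log t| ≤ Y) (u : K)
  rw [hset]
  have hY0 : 0 < Y := by linarith
  obtain ⟨hfin, hcard⟩ := unitBox_finite_and_ncard K hY0.le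
  have hd0 : 0 < d := hd ▸ Module.finrank_pos
  have hι : Fintype.card {w : InfinitePlace K // w ≠ Units.dirichletUnitTheorem.w₀} = d - 1 := by
    rw [← hd, IsTotallyReal.finrank, Fintype.card_subtype_compl, Fintype.card_subtype_eq,
      InfinitePlace.card_eq_nrRealPlaces_add_nrComplexPlaces,
      IsTotallyReal.nrComplexPlaces_eq_zero, add_zero]
  have hd' : ((d - 1 : ℕ) : ℝ) + 1 = d := by exact_mod_cast Nat.sub_add_cancel hd0
  have hBfin := finite_unitLattice_inter_sumBox K hY0.le
  refine ⟨hfin, ?_, ?_⟩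
  · obtain ⟨S, hS, hSY, hvol⟩ := exists_slab {w : InfinitePlace K // w ≠ Units.dirichletUnitTheorem.w₀} hY0
    have h := hvol.trans
      (ZLattice.measureReal_le_ncard_mul_covolume (Units.unitLattice K) volume hS hBfin hSY)
    rw [hι, hd'] at h
    rw [hcard, ← div_eq_mul_inv, div_le_iff₀ (Units.regulator_pos K), Nat.cast_mul]
    rw [mul_inv] at h
    change _ ≤ _ * Units.regulator K at h
    push_cast
    linarith
  · have h := card_le_of_separated hY0.le (by norm_num : (0 : ℝ) < 2 / 5) hBfin.toFinset
      (fun a ha ↦ (hBfin.mem_toFinset.mp ha).2) (fun a ha b hb hab ↦ ?_)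
    · rw [hι, ← Set.ncard_eq_toFinset_card _ hBfin,
        show 2 * Y / (2 / 5) + 1 = 5 * Y + 1 by ring] at h
      rw [hcard]
      push_cast
      have : 0 ≤ (5 * Y + 1) ^ (d - 1) := by positivity
      linarith
    · obtain ⟨⟨u, -, rfl⟩, -⟩ := hBfin.mem_toFinset.mp ha
      obtain ⟨⟨v, -, rfl⟩, -⟩ := hBfin.mem_toFinset.mp hb
      exact logEmbedding_eq_iff.mpr (eq_or_eq_neg_of_logEmbedding_sub_mem hab)
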